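/- Let E be a 0-disjunctive meet-semilattice with least element 0, and let e, f ∈ E be nonzero elements such that every ultrafilter of E contains e if and only if it contains f. Then e = f. -/

import Mathlib

/-- A filter of a meet-semilattice: a nonempty, upward-closed subset closed under meets. -/
def IsSLFilter {E : Type*} [SemilatticeInf E] (F : Set E) : Prop :=
  F.Nonempty ∧ (∀ a ∈ F, ∀ b : E, a ≤ b → b ∈ F) ∧ (∀ a ∈ F, ∀ b ∈ F, a ⊓ b ∈ F)

/-- An ultrafilter of a meet-semilattice with least element: a maximal proper filter. -/
def IsSLUltrafilter {E : Type*} [SemilatticeInf E] [OrderBot E] (F : Set E) : Prop :=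
  IsSLFilter F ∧ ⊥ ∉ F ∧
    ∀ G : Set E, IsSLFilter G → ⊥ ∉ G → F ⊆ G → G = F

/-- Every nonzero element lies in an ultrafilter. -/
theorem exists_isSLUltrafilter_mem {E : Type*} [SemilatticeInf E] [OrderBot E]
    {a : E} (ha : a ≠ ⊥) : ∃ F : Set E, IsSLUltrafilter F ∧ a ∈ F := by
  obtain ⟨M, haM, hM⟩ := zorn_subset_nonempty {F : Set E | IsSLFilter F ∧ ⊥ ∉ F}
    (fun c hc hchain hne => by
      refine ⟨⋃₀ c, ⟨⟨?_, ?_, ?_⟩, ?_⟩, fun s hs => Set.subset_sUnion_of_mem hs⟩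
      · obtain ⟨s, hs⟩ := hne
        obtain ⟨x, hx⟩ := (hc hs).1.1
        exact ⟨x, s, hs, hx⟩
      · rintro x ⟨s, hs, hx⟩ y hxy
        exact ⟨s, hs, (hc hs).1.2.1 x hx y hxy⟩
      · rintro x ⟨s, hs, hx⟩ y ⟨t, ht, hy⟩
        rcases hchain.total hs ht with hst | hts
        · exact ⟨t, ht, (hc ht).1.2.2 x (hst hx) y hy⟩
        · exact ⟨s, hs, (hc hs).1.2.2 x hx y (hts hy)⟩
      · rintro ⟨s, hs, hbot⟩
        exact (hc hs).2 hbot)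
    (Set.Ici a)
    ⟨⟨⟨a, le_rfl⟩, fun _ hx _ hxy => le_trans hx hxy, fun _ hx _ hy => le_inf hx hy⟩,
      fun hbot => ha (le_bot_iff.mp hbot)⟩
  exact ⟨M, ⟨hM.prop.1, hM.prop.2, fun G hG hbot hMG =>
    (hM.eq_of_subset ⟨hG, hbot⟩ hMG).symm⟩, haM le_rfl⟩

/-- In a `0`-disjunctive meet-semilattice, a nonzero `e` is below `f` as soon as every
ultrafilter containing `e` contains `f`. -/
theorem le_of_forall_isSLUltrafilter {E : Type*} [SemilatticeInf E] [OrderBot E]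
    (hdisj : ∀ e f : E, ⊥ < e → e < f → ∃ e' : E, ⊥ < e' ∧ e' < f ∧ e ⊓ e' = ⊥)
    {e f : E} (he : e ≠ ⊥) (h : ∀ F : Set E, IsSLUltrafilter F → e ∈ F → f ∈ F) :
    e ≤ f := by
  by_contra hle
  have hne : e ⊓ f ≠ ⊥ := by
    intro hbot
    obtain ⟨F, hF, heF⟩ := exists_isSLUltrafilter_mem he
    exact hF.2.1 (hbot ▸ hF.1.2.2 e heF f (h F hF heF))
  obtain ⟨d, hpos, hlt, hbot⟩ :=
    hdisj (e ⊓ f) e (bot_lt_iff_ne_bot.mpr hne) (inf_lt_left.mpr hle)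
  obtain ⟨F, hF, hdF⟩ := exists_isSLUltrafilter_mem hpos.ne'
  have heF : e ∈ F := hF.1.2.1 d hdF e hlt.le
  exact hF.2.1 (hbot ▸ hF.1.2.2 _ (hF.1.2.2 e heF f (h F hF heF)) d hdF)

/-- In a `0`-disjunctive meet-semilattice with `0`, two nonzero elements lying in
exactly the same ultrafilters are equal. -/
theorem eq_of_mem_same_ultrafilters {E : Type*} [SemilatticeInf E] [OrderBot E]
    (hdisj : ∀ e f : E, ⊥ < e → e < f → ∃ e' : E, ⊥ < e' ∧ e' < f ∧ e ⊓ e' = ⊥)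
    (e f : E) (he : e ≠ ⊥) (hf : f ≠ ⊥)
    (h : ∀ F : Set E, IsSLUltrafilter F → (e ∈ F ↔ f ∈ F)) :
    e = f := by
  exact le_antisymm (le_of_forall_isSLUltrafilter hdisj he fun F hF => (h F hF).mp)
    (le_of_forall_isSLUltrafilter hdisj hf fun F hF => (h F hF).mpr)
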